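/- Let G be a finite abelian group of order v, D ⊆ G a difference set with |D| = k, 0 < k < v, parameter Λ, and H a subgroup of G of order h such that D is H-fine with associated natural number s. Suppose D is composite with factors A and B: |A| = s, B ⊆ H is a difference set for H, and for every g ∈ G the number of ordered pairs (a,b) ∈ A × B with a + b = g equals 1 if g ∈ D and 0 otherwise. Then for every a ∈ A, {x ∈ H : a + x ∈ D} = B; more generally, for every g ∈ G with g ∉ H there exists c ∈ H with {x ∈ H : g + x ∈ D} = c + B, so that D is an amalgam: every set {x ∈ H : g + x ∈ D} (g ∈ G) is a difference set for H. -/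

import Mathlib

open scoped Classical

/-- Summing the representation counts of differences over a subgroup `H` gives the number of
pairs of elements of a difference set `D` that are congruent modulo `H`. -/
lemma card_pairs_sub_mem {G : Type*} [AddCommGroup G] [Fintype G] (D : Finset G) (Λ : ℕ)
    (hD : ∀ g : G, g ≠ 0 → ((D ×ˢ D).filter (fun p => p.1 - p.2 = g)).card = Λ)
    (H : AddSubgroup G) :
    ((D ×ˢ D).filter (fun p => p.1 - p.2 ∈ H)).card = D.card + Λ * (Nat.card H - 1) := by
  have hcard : (Finset.univ.filter (fun x : G => x ∈ H)).card = Nat.card H := by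
    rw [Nat.card_eq_fintype_card, Fintype.card_subtype]
  have h0 : (0 : G) ∈ Finset.univ.filter (fun x : G => x ∈ H) := by simp
  have hdiag : ((D ×ˢ D).filter (fun p => p.1 - p.2 = 0)).card = D.card := by
    rw [← Finset.diag_card D]
    congr 1
    ext ⟨x, y⟩
    simp only [Finset.mem_filter, Finset.mem_product, Finset.mem_diag, sub_eq_zero]
    constructor
    · rintro ⟨⟨hx, -⟩, h⟩
      exact ⟨hx, h⟩
    · rintro ⟨hx, rfl⟩
      exact ⟨⟨hx, hx⟩, rfl⟩
  rw [Finset.card_eq_sum_card_fiberwise (f := fun p : G × G => p.1 - p.2)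
    (t := Finset.univ.filter (fun x : G => x ∈ H)) (fun p hp => by simp_all),
    ← Finset.add_sum_erase _ _ h0]
  have hfib : ∀ x ∈ H, (((D ×ˢ D).filter (fun p => p.1 - p.2 ∈ H)).filter
      (fun p => p.1 - p.2 = x)) = (D ×ˢ D).filter (fun p => p.1 - p.2 = x) := by
    intro x hx
    ext p
    simp only [Finset.mem_filter, and_assoc, and_congr_right_iff, and_iff_right_iff_imp]
    rintro - rfl
    exact hx
  rw [hfib 0 H.zero_mem, hdiag, Finset.sum_congr rfl (g := fun _ => Λ), Finset.sum_const,
    Finset.card_erase_of_mem h0, hcard, smul_eq_mul, mul_comm]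
  intro x hx
  simp only [Finset.mem_erase, Finset.mem_filter, Finset.mem_univ, true_and] at hx
  rw [hfib x hx.2, hD x hx.1]

section DirectSum

variable {G : Type*} [AddCommGroup G] {A B D : Finset G}

lemma mem_iff_exists_add
    (hfact : ∀ g : G,
      ((A ×ˢ B).filter (fun p => p.1 + p.2 = g)).card = if g ∈ D then 1 else 0) (g : G) :
    g ∈ D ↔ ∃ a ∈ A, ∃ b ∈ B, a + b = g := by
  have h := hfact g
  constructor
  · intro hg
    rw [if_pos hg] at h
    obtain ⟨p, hp⟩ := Finset.card_pos.mp (h ▸ Nat.one_pos)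
    simp only [Finset.mem_filter, Finset.mem_product] at hp
    exact ⟨p.1, hp.1.1, p.2, hp.1.2, hp.2⟩
  · rintro ⟨a, ha, b, hb, hab⟩
    by_contra hg
    rw [if_neg hg, Finset.card_eq_zero] at h
    have : (a, b) ∈ (A ×ˢ B).filter (fun p => p.1 + p.2 = g) := by simp [ha, hb, hab]
    simp [h] at this

lemma add_injOn_product
    (hfact : ∀ g : G,
      ((A ×ˢ B).filter (fun p => p.1 + p.2 = g)).card = if g ∈ D then 1 else 0) :
    Set.InjOn (fun p : G × G => p.1 + p.2) (A ×ˢ B : Finset (G × G)) := by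
  intro p hp q hq hpq
  have hle : ((A ×ˢ B).filter (fun r => r.1 + r.2 = q.1 + q.2)).card ≤ 1 := by
    rw [hfact]; split_ifs <;> simp
  exact Finset.card_le_one.mp hle p (Finset.mem_filter.mpr ⟨hp, hpq⟩) q
    (Finset.mem_filter.mpr ⟨hq, rfl⟩)

lemma image_add_product
    (hfact : ∀ g : G,
      ((A ×ˢ B).filter (fun p => p.1 + p.2 = g)).card = if g ∈ D then 1 else 0) :
    (A ×ˢ B).image (fun p => p.1 + p.2) = D := by
  ext g
  rw [mem_iff_exists_add hfact g]
  simp only [Finset.mem_image, Finset.mem_product, Prod.exists]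
  constructor
  · rintro ⟨a, b, ⟨ha, hb⟩, h⟩
    exact ⟨a, ha, b, hb, h⟩
  · rintro ⟨a, ha, b, hb, h⟩
    exact ⟨a, b, ⟨ha, hb⟩, h⟩

lemma card_eq_mul_card
    (hfact : ∀ g : G,
      ((A ×ˢ B).filter (fun p => p.1 + p.2 = g)).card = if g ∈ D then 1 else 0) :
    D.card = A.card * B.card := by
  rw [← image_add_product hfact, Finset.card_image_of_injOn (add_injOn_product hfact),
    Finset.card_product]

/-- If `D` is the direct sum of `A` and `B ⊆ H`, each pair of `H`-congruent elements of `A` gives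
`|B|²` pairs of `H`-congruent elements of `D`. -/
lemma card_pairs_sub_mem_eq_mul (H : AddSubgroup G) (hBH : ∀ b ∈ B, b ∈ H)
    (hfact : ∀ g : G,
      ((A ×ˢ B).filter (fun p => p.1 + p.2 = g)).card = if g ∈ D then 1 else 0) :
    ((D ×ˢ D).filter (fun p => p.1 - p.2 ∈ H)).card =
      ((A ×ˢ A).filter (fun p => p.1 - p.2 ∈ H)).card * B.card ^ 2 := by
  have hmem : ∀ a a' b b' : G, b ∈ B → b' ∈ B → (a + b - (a' + b') ∈ H ↔ a - a' ∈ H) := by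
    intro a a' b b' hb hb'
    rw [add_sub_add_comm, H.add_mem_cancel_right (H.sub_mem (hBH b hb) (hBH b' hb'))]
  rw [sq, ← Finset.card_product B B, ← Finset.card_product]
  symm
  refine Finset.card_bij (fun q _ => (q.1.1 + q.2.1, q.1.2 + q.2.2)) ?_ ?_ ?_
  · rintro ⟨⟨a, a'⟩, b, b'⟩ hq
    simp only [Finset.mem_filter, Finset.mem_product] at hq ⊢
    obtain ⟨⟨⟨ha, ha'⟩, hH⟩, hb, hb'⟩ := hq
    exact ⟨⟨(mem_iff_exists_add hfact _).2 ⟨a, ha, b, hb, rfl⟩,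
      (mem_iff_exists_add hfact _).2 ⟨a', ha', b', hb', rfl⟩⟩, (hmem a a' b b' hb hb').2 hH⟩
  · rintro ⟨⟨a, a'⟩, b, b'⟩ hq ⟨⟨c, c'⟩, d, d'⟩ hr h
    simp only [Finset.mem_filter, Finset.mem_product] at hq hr
    simp only [Prod.mk.injEq] at h
    have h1 := @add_injOn_product _ _ _ _ _ hfact (a, b) (by simp [hq]) (c, d) (by simp [hr]) h.1
    have h2 := @add_injOn_product _ _ _ _ _ hfact (a', b') (by simp [hq]) (c', d')
      (by simp [hr]) h.2
    simp_all
  · rintro ⟨d, d'⟩ hd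
    simp only [Finset.mem_filter, Finset.mem_product] at hd
    obtain ⟨⟨hd, hd'⟩, hH⟩ := hd
    obtain ⟨a, ha, b, hb, rfl⟩ := (mem_iff_exists_add hfact _).1 hd
    obtain ⟨a', ha', b', hb', rfl⟩ := (mem_iff_exists_add hfact _).1 hd'
    refine ⟨((a, a'), b, b'), ?_, rfl⟩
    simp only [Finset.mem_filter, Finset.mem_product]
    exact ⟨⟨⟨ha, ha'⟩, (hmem a a' b b' hb hb').1 hH⟩, hb, hb'⟩

end DirectSum

/-- The numerical conditions on an `H`-fine difference set of size `k = s * b` force the number `N`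
of pairs of `H`-congruent elements of a factor of size `s` to be `s`. -/
lemma eq_of_fine_parameters {v k Λ h s b N : ℕ} (hk0 : 0 < k) (hkv : k < v) (hk : k = s * b)
    (hfine : h * (s + 1) = v) (hS : s ^ 2 * (v - k) = k * (v - 1))
    (hΛ : k * k = k + Λ * (v - 1)) (hN : N * b ^ 2 = k + Λ * (h - 1)) : N = s := by
  have hh : 1 ≤ h := by
    rcases Nat.eq_zero_or_pos h with rfl | hh
    · omega
    · exact hh
  have hs : 0 < s := Nat.pos_of_ne_zero fun hs => by simp [hs] at hk; omega
  have hb : 0 < b := Nat.pos_of_ne_zero fun hb => by simp [hb] at hk; omega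
  have hv : 1 < v := by omega
  zify [hh, hv.le, hkv.le] at *
  have e1 : (s : ℤ) * (v - s * b) = b * (v - 1) := by
    apply mul_left_cancel₀ hs.ne'
    rw [hk] at hS
    linear_combination hS
  have e2 : (k : ℤ) - Λ = b ^ 2 := by
    apply mul_right_cancel₀ (sub_pos.2 hv).ne'
    linear_combination hΛ + b * e1 + (v - k - s * b : ℤ) * hk
  have e3 : (Λ : ℤ) * h = b ^ 2 * (s - 1) := by
    apply mul_right_cancel₀ (show (s + 1 : ℤ) ≠ 0 by positivity)
    have : (k : ℤ) ^ 2 = s ^ 2 * b ^ 2 := by rw [hk]; ring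
    linear_combination Λ * hfine - hΛ + this - e2
  apply mul_right_cancel₀ (show (b ^ 2 : ℤ) ≠ 0 by positivity)
  linear_combination hN + e2 + e3

/-- If only `|A|` pairs of elements of `A` are congruent modulo `H`, then distinct elements of `A`
lie in distinct cosets. -/
lemma eq_of_sub_mem_of_card_pairs {G : Type*} [AddCommGroup G] {A : Finset G} {H : AddSubgroup G}
    (hN : ((A ×ˢ A).filter (fun p => p.1 - p.2 ∈ H)).card = A.card) {a a' : G} (ha : a ∈ A)
    (ha' : a' ∈ A) (h : a - a' ∈ H) : a = a' := by
  have hsub : A.diag ⊆ (A ×ˢ A).filter (fun p => p.1 - p.2 ∈ H) := by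
    rintro ⟨x, y⟩ hxy
    have hxy' := Finset.mem_diag.1 hxy
    simp_all
  have heq := Finset.eq_of_subset_of_card_le hsub (by rw [hN, Finset.diag_card])
  have : (a, a') ∈ A.diag := by
    rw [heq]
    simp [ha, ha', h]
  exact (Finset.mem_diag.1 this).2

/-- A set of `[G : H] - 1` elements outside `H`, pairwise incongruent modulo `H`, meets every
nontrivial coset of `H`. -/
lemma exists_mem_sub_mem_of_card {G : Type*} [AddCommGroup G] [Fintype G] {A : Finset G}
    {H : AddSubgroup G} (hcard : Nat.card H * (A.card + 1) = Fintype.card G)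
    (hAH : ∀ a ∈ A, a ∉ H) (hinj : ∀ a ∈ A, ∀ a' ∈ A, a - a' ∈ H → a = a') {g : G}
    (hg : g ∉ H) : ∃ a ∈ A, a - g ∈ H := by
  have hq : Fintype.card (G ⧸ H) = A.card + 1 := by
    have h := H.card_eq_card_quotient_mul_card_addSubgroup
    rw [Nat.card_eq_fintype_card, ← hcard, mul_comm, Nat.card_eq_fintype_card (α := G ⧸ H)] at h
    exact (Nat.eq_of_mul_eq_mul_right Nat.card_pos h).symm
  have hsub : A.image (QuotientAddGroup.mk : G → G ⧸ H) ⊆ Finset.univ.erase 0 := by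
    intro x hx
    obtain ⟨a, ha, rfl⟩ := Finset.mem_image.1 hx
    simpa [QuotientAddGroup.eq_zero_iff] using hAH a ha
  have heq := Finset.eq_of_subset_of_card_le hsub (by
    rw [Finset.card_image_of_injOn, Finset.card_erase_of_mem (Finset.mem_univ _),
      Finset.card_univ, hq, Nat.add_sub_cancel]
    intro a ha a' ha' h
    exact hinj a ha a' ha' (QuotientAddGroup.eq_iff_sub_mem.1 h))
  have hgm : (g : G ⧸ H) ∈ A.image (QuotientAddGroup.mk : G → G ⧸ H) := by
    rw [heq]
    simpa [QuotientAddGroup.eq_zero_iff] using hg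
  obtain ⟨a, ha, h⟩ := Finset.mem_image.1 hgm
  exact ⟨a, ha, QuotientAddGroup.eq_iff_sub_mem.1 h⟩

/-- Translating a finite set does not change its representation counts of differences. -/
lemma natCard_pairs_translate {G : Type*} [AddCommGroup G] (B : Finset G) (c y : G)
    {P : G → Prop} (hP : ∀ x, P x ↔ ∃ b ∈ B, x = c + b) :
    Nat.card {p : G × G // P p.1 ∧ P p.2 ∧ p.1 - p.2 = y} =
      ((B ×ˢ B).filter (fun p => p.1 - p.2 = y)).card := by
  have hP' : ∀ b, P (c + b) ↔ b ∈ B := fun b => by simp [hP]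
  rw [← Nat.card_eq_finsetCard]
  symm
  refine Nat.card_congr ((Equiv.prodCongr (Equiv.addLeft c) (Equiv.addLeft c)).subtypeEquiv ?_)
  rintro ⟨b, b'⟩
  simp [hP', and_assoc]

/-- If the `H`-fine difference set `D` (with associated natural number `s`)
is composite with factors `A` and `B`, then `{x ∈ H : a + x ∈ D} = B` for every `a ∈ A`; more
generally, for every `g ∉ H` the set `{x ∈ H : g + x ∈ D}` is a translate `c + B` of `B` by
some `c ∈ H`, so `D` is an amalgam: every `{x ∈ H : g + x ∈ D}` is a difference set for `H`. -/
theorem stmt_10 {G : Type*} [AddCommGroup G] [Fintype G]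
    (D : Finset G) (Λ : ℕ)
    (hk0 : 0 < D.card) (hkv : D.card < Fintype.card G)
    (hD : ∀ g : G, g ≠ 0 → ((D ×ˢ D).filter (fun p => p.1 - p.2 = g)).card = Λ)
    (H : AddSubgroup G) (s : ℕ)
    (hdisj : ∀ x ∈ D, x ∉ H)
    (hfine : Nat.card H * (s + 1) = Fintype.card G)
    (hS : s ^ 2 * (Fintype.card G - D.card) = D.card * (Fintype.card G - 1))
    (A B : Finset G) (hA : A.card = s) (hBH : ∀ b ∈ B, b ∈ H)
    (hBds : ∃ μ : ℕ, ∀ x : G, x ∈ H → x ≠ 0 →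
      ((B ×ˢ B).filter (fun p => p.1 - p.2 = x)).card = μ)
    (hfact : ∀ g : G,
      ((A ×ˢ B).filter (fun p => p.1 + p.2 = g)).card = if g ∈ D then 1 else 0) :
    (∀ a ∈ A, ∀ x : G, (x ∈ H ∧ a + x ∈ D) ↔ x ∈ B) ∧
    (∀ g : G, g ∉ H → ∃ c ∈ H, ∀ x : G, (x ∈ H ∧ g + x ∈ D) ↔ ∃ b ∈ B, x = c + b) ∧
    (∀ g : G, ∃ μ : ℕ, ∀ y : G, y ∈ H → y ≠ 0 →
      Nat.card {p : G × G //
        (p.1 ∈ H ∧ g + p.1 ∈ D) ∧ (p.2 ∈ H ∧ g + p.2 ∈ D) ∧ p.1 - p.2 = y} = μ) := by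
  have hk := card_eq_mul_card hfact
  have hB : 0 < B.card := Nat.pos_of_ne_zero fun h => by simp [h] at hk; simp [hk] at hk0
  obtain ⟨b₀, hb₀⟩ := Finset.card_pos.1 hB
  have hAH : ∀ a ∈ A, a ∉ H := fun a ha haH =>
    hdisj _ ((mem_iff_exists_add hfact _).2 ⟨a, ha, b₀, hb₀, rfl⟩) (H.add_mem haH (hBH _ hb₀))
  have htop : D.card * D.card = D.card + Λ * (Fintype.card G - 1) := by
    simpa [Finset.card_product] using card_pairs_sub_mem D Λ hD ⊤
  have hN : ((A ×ˢ A).filter (fun p => p.1 - p.2 ∈ H)).card = A.card := by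
    rw [hA] at hk ⊢
    refine eq_of_fine_parameters hk0 hkv hk hfine hS htop ?_
    rw [← card_pairs_sub_mem_eq_mul H hBH hfact, card_pairs_sub_mem D Λ hD H]
  have hinj : ∀ a ∈ A, ∀ a' ∈ A, a - a' ∈ H → a = a' := fun a ha a' ha' h =>
    eq_of_sub_mem_of_card_pairs hN ha ha' h
  have h1 : ∀ a ∈ A, ∀ x : G, (x ∈ H ∧ a + x ∈ D) ↔ x ∈ B := by
    intro a ha x
    constructor
    · rintro ⟨hx, hax⟩
      obtain ⟨a', ha', b, hb, h⟩ := (mem_iff_exists_add hfact _).1 hax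
      have haa : a' = a := hinj a' ha' a ha (by
        rw [show a' - a = x - b by rw [sub_eq_sub_iff_add_eq_add, h, add_comm]]
        exact H.sub_mem hx (hBH b hb))
      rw [haa] at h
      exact add_left_cancel h ▸ hb
    · exact fun hx => ⟨hBH x hx, (mem_iff_exists_add hfact _).2 ⟨a, ha, x, hx, rfl⟩⟩
  have h2 : ∀ g : G, g ∉ H → ∃ c ∈ H, ∀ x : G, (x ∈ H ∧ g + x ∈ D) ↔ ∃ b ∈ B, x = c + b := by
    intro g hg
    obtain ⟨a, ha, hag⟩ := exists_mem_sub_mem_of_card (by rw [hA, hfine]) hAH hinj hg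
    refine ⟨a - g, hag, fun x => ?_⟩
    have hx := h1 a ha (x - (a - g))
    rw [sub_eq_add_neg, H.add_mem_cancel_right (H.neg_mem hag),
      show a + (x + -(a - g)) = g + x by abel, ← sub_eq_add_neg] at hx
    constructor
    · exact fun h => ⟨x - (a - g), hx.1 h, by abel⟩
    · rintro ⟨b, hb, rfl⟩
      exact hx.2 (by simpa using hb)
  refine ⟨h1, h2, fun g => ?_⟩
  by_cases hg : g ∈ H
  · refine ⟨0, fun y _ _ => ?_⟩
    have : IsEmpty {p : G × G //
        (p.1 ∈ H ∧ g + p.1 ∈ D) ∧ (p.2 ∈ H ∧ g + p.2 ∈ D) ∧ p.1 - p.2 = y} :=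
      ⟨fun p => hdisj _ p.2.1.2 (H.add_mem hg p.2.1.1)⟩
    exact Nat.card_of_isEmpty
  · obtain ⟨c, -, hc⟩ := h2 g hg
    obtain ⟨μ, hμ⟩ := hBds
    exact ⟨μ, fun y hy hy0 => (natCard_pairs_translate B c y hc).trans (hμ y hy hy0)⟩
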